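/- arXiv:2112.06065 — 5 statements merged into one kernel-verified Lean document; each statement's English description precedes it below -/
import Mathlib

section
/- Let G be a finite group and V a finite-dimensional real vector space carrying a linear G-action. Then V has a G-invariant basis up to sign if and only if there exists a finite family (Lᵢ) of one-dimensional subspaces of V such that V is the internal direct sum of the Lᵢ (the family is independent and spans V) and the G-action permutes the family: for every g ∈ G and every index i there exists an index j with g • Lᵢ = Lⱼ. (This is the internal formulation of the statement that V has a G-invariant basis up to sign if and only if V is a direct sum of subrepresentations induced from one-dimensional representations of subgroups of G.) -/
/-- A basis `b` of a real vector space `V` carrying a linear `G`-action (given by a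
representation `ρ`) is *`G`-invariant up to sign* if every group element sends every basis
vector to plus or minus another basis vector. -/
def IsInvSignBasis {G V : Type*} {ι : Type*} [Group G] [AddCommGroup V] [Module ℝ V]
    (ρ : Representation ℝ G V) (b : Module.Basis ι ℝ V) : Prop :=
  ∀ (g : G) (i : ι), ∃ i', ρ g (b i) = b i' ∨ ρ g (b i) = -b i'

/-- `V` has a `G`-invariant basis up to sign. -/
def HasInvSignBasis {G V : Type*} [Group G] [AddCommGroup V] [Module ℝ V]
    (ρ : Representation ℝ G V) : Prop :=
  ∃ (ι : Type) (b : Module.Basis ι ℝ V), IsInvSignBasis ρ b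

/-- A finite-dimensional real representation of a finite group has an invariant basis up to
sign if and only if the space is an internal direct sum of a finite family of lines that is
permuted by the group action. -/
theorem hasInvSignBasis_iff_directSum_of_lines {G V : Type*} [Group G] [Finite G]
    [AddCommGroup V] [Module ℝ V] [FiniteDimensional ℝ V] (ρ : Representation ℝ G V) :
    HasInvSignBasis ρ ↔
      ∃ (ι : Type) (_ : Finite ι) (L : ι → Submodule ℝ V),
        (∀ i, Module.finrank ℝ (L i) = 1) ∧
        iSupIndep L ∧ (⨆ i, L i) = ⊤ ∧
        ∀ (g : G) (i : ι), ∃ j, (L i).map (ρ g) = L j := by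
  classical
  constructor
  · rintro ⟨ι, b, hb⟩
    refine ⟨ι, Module.Finite.finite_basis b, fun i => Submodule.span ℝ {b i},
      fun i => finrank_span_singleton (b.ne_zero i),
      b.linearIndependent.iSupIndep_span_singleton, ?_, ?_⟩
    · rw [← Submodule.span_range_eq_iSup, b.span_eq]
    · intro g i
      obtain ⟨j, hj⟩ := hb g i
      refine ⟨j, ?_⟩
      rw [Submodule.map_span, Set.image_singleton]
      rcases hj with hj | hj
      · rw [hj]
      · rw [hj, ← Set.neg_singleton, Submodule.span_neg]
  · rintro ⟨ι, _, L, h1, hind, htop, hperm⟩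
    have := Fintype.ofFinite G
    let e := Module.finBasis ℝ V
    -- a `G`-invariant norm
    let N : V → ℝ := fun v => ∑ g : G, ∑ k, |e.repr (ρ g v) k|
    have hNsmul : ∀ (c : ℝ) v, N (c • v) = |c| * N v := by
      intro c v
      simp [N, abs_mul, Finset.mul_sum]
    have hNinv : ∀ h v, N (ρ h v) = N v := by
      intro h v
      refine Fintype.sum_equiv (Equiv.mulRight h) _ _ fun g => ?_
      simp [map_mul]
    have hNpos : ∀ v, v ≠ 0 → 0 < N v := by
      intro v hv
      refine Finset.sum_pos' (fun g _ => Finset.sum_nonneg fun k _ => abs_nonneg _)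
        ⟨1, Finset.mem_univ _, ?_⟩
      have : e.repr v ≠ 0 := by simpa using hv
      obtain ⟨k, hk⟩ := Finsupp.ne_iff.1 this
      refine Finset.sum_pos' (fun k _ => abs_nonneg _) ⟨k, Finset.mem_univ _, ?_⟩
      simpa using hk
    have hex : ∀ i, ∃ v ∈ L i, v ≠ 0 ∧ N v = 1 ∧ ∀ w ∈ L i, ∃ c : ℝ, c • v = w := by
      intro i
      obtain ⟨⟨v, hv⟩, hv0, hvs⟩ := finrank_eq_one_iff'.1 (h1 i)
      have hv0' : v ≠ 0 := fun h => hv0 (by simpa using h)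
      have hp := hNpos v hv0'
      refine ⟨(N v)⁻¹ • v, (L i).smul_mem _ hv, smul_ne_zero (inv_ne_zero hp.ne') hv0', ?_, ?_⟩
      · rw [hNsmul, abs_of_pos (inv_pos.2 hp), inv_mul_cancel₀ hp.ne']
      · intro w hw
        obtain ⟨c, hc⟩ := hvs ⟨w, hw⟩
        refine ⟨c * N v, ?_⟩
        rw [smul_smul, mul_assoc, mul_inv_cancel₀ hp.ne', mul_one]
        exact congrArg Subtype.val hc
    choose v hvL hv0 hvN hvs using hex
    have hli : LinearIndependent ℝ v := hind.linearIndependent L hvL hv0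
    have hsp : ⊤ ≤ Submodule.span ℝ (Set.range v) := by
      rw [← htop]
      refine iSup_le fun i w hw => ?_
      obtain ⟨c, rfl⟩ := hvs i w hw
      exact Submodule.smul_mem _ _ (Submodule.subset_span ⟨i, rfl⟩)
    refine ⟨ι, Module.Basis.mk hli hsp, fun g i => ?_⟩
    obtain ⟨j, hj⟩ := hperm g i
    refine ⟨j, ?_⟩
    simp only [Module.Basis.mk_apply]
    have hm : ρ g (v i) ∈ L j := hj ▸ Submodule.mem_map_of_mem (hvL i)
    obtain ⟨c, hc⟩ := hvs j _ hm
    have hc1 : |c| = 1 := by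
      have := hNsmul c (v j)
      rw [hc, hNinv, hvN, hvN, mul_one] at this
      exact this.symm
    rw [← hc]
    rcases eq_or_eq_neg_of_abs_eq hc1 with h | h
    · left; simp [h]
    · right; simp [h]
end

section
/- Let G be a finite group, K ≤ G a subgroup, and V a finite-dimensional real vector space carrying a linear G-action. Let W be a K-stable subspace of V, let T ⊆ G be a set of representatives of the left cosets of K in G, and suppose that the family of translates (t • W)_{t ∈ T} is independent with sum equal to V (so that V is induced by W, V = Ind_K^G W). If W has a K-invariant basis up to sign, then V has a G-invariant basis up to sign. -/
/-- If `V = Ind_K^G W` is induced from a `K`-stable subspace `W` (the translates of `W` by a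
set `T` of left-coset representatives of `K` in `G` are independent with sum `V`), and `W`
has a `K`-invariant basis up to sign, then `V` has a `G`-invariant basis up to sign. -/
theorem hasInvSignBasis_of_induced {G V : Type*} [Group G] [Finite G]
    [AddCommGroup V] [Module ℝ V] [FiniteDimensional ℝ V]
    (ρ : Representation ℝ G V) (K : Subgroup G) (W : Submodule ℝ V)
    (hW : ∀ k : K, W.map (ρ (k : G)) = W)
    (T : Set G)
    (hT : Function.Bijective (fun t : T => (QuotientGroup.mk (t : G) : G ⧸ K)))
    (hind : iSupIndep (fun t : T => W.map (ρ (t : G))))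
    (hsum : (⨆ t : T, W.map (ρ (t : G))) = ⊤)
    (hWbasis : ∃ (ι : Type) (bW : Module.Basis ι ℝ W),
      ∀ (k : K) (i : ι), ∃ i',
        ρ (k : G) (bW i : V) = (bW i' : V) ∨ ρ (k : G) (bW i : V) = -(bW i' : V)) :
    HasInvSignBasis ρ := by
  classical
  obtain ⟨ι, bW, hb⟩ := hWbasis
  have hinj : ∀ g : G, Function.Injective (ρ g) := by
    intro g x y h
    have h2 := congrArg (ρ g⁻¹) h
    simpa using h2
  have hint : DirectSum.IsInternal (fun t : T => W.map (ρ (t : G))) :=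
    DirectSum.isInternal_submodule_of_iSupIndep_of_iSup_eq_top hind hsum
  let v : ∀ t : T, Module.Basis ι ℝ (W.map (ρ (t : G))) := fun t =>
    bW.map (Submodule.equivMapOfInjective (ρ (t : G)) (hinj t) W)
  let B := hint.collectedBasis v
  have hB : ∀ a, B a = ρ (a.1 : G) (bW a.2 : V) := by
    intro a
    simp [B, v]
  have hfin : Finite (Σ _ : T, ι) := Module.Finite.finite_basis B
  obtain ⟨n, ⟨e⟩⟩ := Finite.exists_equiv_fin (Σ _ : T, ι)
  refine ⟨Fin n, B.reindex e, ?_⟩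
  intro g j
  obtain ⟨⟨t, i⟩, rfl⟩ := e.surjective j
  obtain ⟨s, hs⟩ := hT.2 (QuotientGroup.mk (g * (t : G)))
  have hk : (s : G)⁻¹ * (g * t) ∈ K := QuotientGroup.eq.1 hs
  obtain ⟨i', hi'⟩ := hb ⟨_, hk⟩ i
  have key : ρ g (ρ (t : G) (bW i : V)) = ρ (s : G) (ρ ((s : G)⁻¹ * (g * t)) (bW i : V)) := by
    rw [← Module.End.mul_apply, ← Module.End.mul_apply, ← map_mul, ← map_mul,
      mul_inv_cancel_left]
  refine ⟨e ⟨s, i'⟩, ?_⟩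
  simp only [Module.Basis.reindex_apply, Equiv.symm_apply_apply, hB, key]
  rcases hi' with h | h
  · left
    exact congrArg _ h
  · right
    rw [← map_neg]
    exact congrArg _ h
end

section
/- Let m, n ∈ ℕ and let V = (Fin m → ℝ) × (Fin n → ℝ²), where the cyclic group ℤ/3 = ⟨g⟩ acts trivially on the first factor and acts on each ℝ²-component of the second factor by rotation through 2π/3, i.e., by the matrix [[-1/2, -√3/2], [√3/2, -1/2]] (so V ≅ m·1 ⊕ n·2). Then V has a ℤ/3-invariant basis up to sign if and only if m ≥ n. -/
/-- Rotation of `ℝ²` through `2π/3`, the action of the generator of `ℤ/3` in the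
two-dimensional rotation representation. -/
noncomputable def rot : (Fin 2 → ℝ) →ₗ[ℝ] (Fin 2 → ℝ) :=
  Matrix.toLin' !![-(1 / 2 : ℝ), -(Real.sqrt 3) / 2; (Real.sqrt 3) / 2, -(1 / 2 : ℝ)]

/-- The action of the generator of `ℤ/3` on `V = m·1 ⊕ n·2`, i.e. on
`(Fin m → ℝ) × (Fin n → ℝ²)`: trivially on the first factor and by rotation through
`2π/3` on each `ℝ²`-component of the second factor. -/
noncomputable def genAct (m n : ℕ) :
    ((Fin m → ℝ) × (Fin n → Fin 2 → ℝ)) →ₗ[ℝ] ((Fin m → ℝ) × (Fin n → Fin 2 → ℝ)) :=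
  LinearMap.prodMap LinearMap.id (LinearMap.compLeft rot (Fin n))

theorem rot_apply (v : Fin 2 → ℝ) :
    rot v = ![-(1/2) * v 0 - Real.sqrt 3 / 2 * v 1, Real.sqrt 3 / 2 * v 0 - (1/2) * v 1] := by
  ext i
  fin_cases i <;> simp [rot, Matrix.mulVec, dotProduct, Fin.sum_univ_two] <;> ring

theorem rot_cube (v : Fin 2 → ℝ) : rot (rot (rot v)) = v := by
  have h : Real.sqrt 3 * Real.sqrt 3 = 3 := Real.mul_self_sqrt (by norm_num)
  ext i
  fin_cases i <;> simp [rot_apply] <;> grind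

theorem genAct_apply (m n : ℕ) (x : (Fin m → ℝ) × (Fin n → Fin 2 → ℝ)) :
    genAct m n x = (x.1, fun j => rot (x.2 j)) := rfl

theorem genAct_cube (m n : ℕ) (x : (Fin m → ℝ) × (Fin n → Fin 2 → ℝ)) :
    genAct m n (genAct m n (genAct m n x)) = x := by
  simp [genAct_apply, rot_cube]

theorem trace_genAct (m n : ℕ) :
    LinearMap.trace ℝ _ (genAct m n) = (m : ℝ) - n := by
  classical
  rw [LinearMap.trace_eq_matrix_trace ℝ
    ((Pi.basisFun ℝ (Fin m)).prod (Pi.basis (fun _ : Fin n => Pi.basisFun ℝ (Fin 2))))]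
  simp [Matrix.trace, LinearMap.toMatrix_apply, genAct_apply, Fintype.sum_sigma,
    Fin.sum_univ_two, rot_apply]
  ring

/-- The three vectors of an equilateral triangle. -/
noncomputable def triVec : Fin 3 → Fin 2 → ℝ :=
  ![![1, 0], ![-(1/2), Real.sqrt 3 / 2], ![-(1/2), -(Real.sqrt 3 / 2)]]

theorem rot_triVec (l : Fin 3) : rot (triVec l) = triVec (l + 1) := by
  have h : Real.sqrt 3 * Real.sqrt 3 = 3 := Real.mul_self_sqrt (by norm_num)
  ext i
  fin_cases l <;> fin_cases i <;> simp [rot_apply, triVec] <;> grind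

/-- The invariant family. -/
noncomputable def famVec (n d : ℕ) :
    Fin d ⊕ (Fin n × Fin 3) → (Fin (n + d) → ℝ) × (Fin n → Fin 2 → ℝ) :=
  Sum.elim (fun j => (Pi.single (Fin.natAdd n j) 1, 0))
    (fun p => (Pi.single (Fin.castAdd d p.1) 1, Pi.single p.1 (triVec p.2)))

theorem genAct_famVec (n d : ℕ) (i : Fin d ⊕ (Fin n × Fin 3)) :
    ∃ i', genAct (n + d) n (famVec n d i) = famVec n d i' := by
  rcases i with j | ⟨j, l⟩
  · refine ⟨Sum.inl j, ?_⟩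
    rw [genAct_apply]
    refine Prod.ext rfl ?_
    funext a
    simp [famVec]
  · refine ⟨Sum.inr (j, l + 1), ?_⟩
    rw [genAct_apply]
    refine Prod.ext rfl ?_
    funext a
    by_cases h : a = j
    · subst h; simp [famVec, rot_triVec]
    · simp [famVec, h]

theorem famVec_li (n d : ℕ) : LinearIndependent ℝ (famVec n d) := by
  rw [Fintype.linearIndependent_iff]
  intro c hc
  have h3 : (0:ℝ) < Real.sqrt 3 := Real.sqrt_pos.2 (by norm_num)
  rw [Fintype.sum_sum_type, Fintype.sum_prod_type] at hc
  have h1 := congrArg Prod.fst hc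
  have h2 := congrArg Prod.snd hc
  rintro (j | ⟨j, l⟩)
  · have := congrFun h1 (Fin.natAdd n j)
    have hne : ∀ x : Fin n, Fin.natAdd n j ≠ Fin.castAdd d x := by
      intro x hx; have := congrArg Fin.val hx; simp at this; omega
    simpa [famVec, Prod.fst_sum, Finset.sum_apply, Pi.single_apply, hne] using this
  · have a1 := congrFun h1 (Fin.castAdd d j)
    have a2 := congrFun (congrFun h2 j) 0
    have a3 := congrFun (congrFun h2 j) 1
    have hne : ∀ x : Fin d, Fin.castAdd d j ≠ Fin.natAdd n x := by
      intro x hx; have := congrArg Fin.val hx; simp at this; omega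
    simp [famVec, Prod.fst_sum, Finset.sum_apply, Pi.single_apply, hne,
      Fin.sum_univ_three, Finset.sum_add_distrib] at a1
    simp [famVec, Prod.snd_sum, Finset.sum_apply, Pi.single_apply, ite_apply,
      Fin.sum_univ_three, Finset.sum_add_distrib, triVec] at a2 a3
    have a4 : c (Sum.inr (j, 1)) = c (Sum.inr (j, 2)) := by
      have : Real.sqrt 3 * (c (Sum.inr (j, 1)) - c (Sum.inr (j, 2))) = 0 := by linarith
      rcases mul_eq_zero.1 this with h | h
      · exact absurd h h3.ne'
      · linarith
    fin_cases l <;> simp <;> linarith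

/-- `m·1 ⊕ n·2` has a `ℤ/3`-invariant basis up to sign (invariance being demanded for every
power of the generator, i.e. for every group element) if and only if `m ≥ n`. -/
theorem invariant_basis_iff_ge (m n : ℕ) :
    (∃ (ι : Type) (b : Module.Basis ι ℝ ((Fin m → ℝ) × (Fin n → Fin 2 → ℝ))),
      ∀ (k : ℕ) (i : ι), ∃ i',
        ((genAct m n) ^ k) (b i) = b i' ∨ ((genAct m n) ^ k) (b i) = -b i') ↔ m ≥ n := by
  classical
  constructor
  · rintro ⟨ι, b, hb⟩
    haveI : Finite ι := Module.Finite.finite_basis b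
    haveI := Fintype.ofFinite ι
    have ht := trace_genAct m n
    rw [LinearMap.trace_eq_matrix_trace ℝ b] at ht
    have hn : 0 ≤ Matrix.trace (LinearMap.toMatrix b b (genAct m n)) := by
      refine Finset.sum_nonneg fun i _ => ?_
      rw [Matrix.diag_apply, LinearMap.toMatrix_apply]
      obtain ⟨i', h | h⟩ := hb 1 i
      · rw [pow_one] at h
        rw [h, b.repr_self, Finsupp.single_apply]
        split_ifs <;> norm_num
      · rw [pow_one] at h
        by_cases hi : i' = i
        · subst hi
          exfalso
          have h3 := genAct_cube m n (b i')
          simp only [h, map_neg, neg_neg] at h3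
          exact b.ne_zero i' (self_eq_neg.1 h3.symm)
        · rw [h, map_neg, b.repr_self]
          simp [hi]
    rw [ht] at hn
    have : (n : ℝ) ≤ m := by linarith
    exact_mod_cast this
  · intro h
    obtain ⟨d, rfl⟩ := Nat.exists_eq_add_of_le h
    have hcard : Fintype.card (Fin d ⊕ (Fin n × Fin 3)) =
        Module.finrank ℝ ((Fin (n + d) → ℝ) × (Fin n → Fin 2 → ℝ)) := by
      simp [Module.finrank_prod, Module.finrank_pi_fintype]
      omega
    have key : ∀ (k : ℕ) (i : Fin d ⊕ (Fin n × Fin 3)), ∃ i',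
        ((genAct (n + d) n) ^ k) (famVec n d i) = famVec n d i' := by
      intro k
      induction k with
      | zero => intro i; exact ⟨i, by simp⟩
      | succ k ih =>
        intro i
        obtain ⟨i1, h1⟩ := genAct_famVec n d i
        obtain ⟨i2, h2⟩ := ih i1
        exact ⟨i2, by rw [pow_succ, Module.End.mul_apply, h1, h2]⟩
    by_cases hne : Nonempty (Fin d ⊕ (Fin n × Fin 3))
    · refine ⟨_, basisOfLinearIndependentOfCardEqFinrank (famVec_li n d) hcard, ?_⟩
      intro k i
      obtain ⟨i', h'⟩ := key k i
      exact ⟨i', Or.inl (by simpa using h')⟩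
    · rw [not_nonempty_iff] at hne
      have h0 : Fintype.card (Fin d ⊕ (Fin n × Fin 3)) = 0 := Fintype.card_eq_zero
      rw [h0] at hcard
      haveI := Module.finrank_zero_iff.1 hcard.symm
      exact ⟨Empty, Module.Basis.empty _, fun _ i => i.elim⟩
end

section
/- Let V be a finite-dimensional real vector space with a linear action of the cyclic group ℤ/3 = ⟨g⟩, and let V^{ℤ/3} = {v ∈ V : g • v = v} denote the subspace of fixed vectors. Then V has a ℤ/3-invariant basis up to sign if and only if 3 · dim(V^{ℤ/3}) ≥ dim V. -/
/-- A real space with an operator satisfying `T² + T + 1 = 0` is a complex vector space. -/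
lemma exists_complex_basis {W : Type*} [AddCommGroup W] [Module ℝ W] [FiniteDimensional ℝ W]
    (T : W →ₗ[ℝ] W) (hT : ∀ x, T (T x) + T x + x = 0) :
    ∃ (n : ℕ) (w : Fin n → W), Module.finrank ℝ W = 2 * n ∧
      ∀ S : Submodule ℝ W, (∀ j, w j ∈ S) → (∀ j, T (w j) ∈ S) → ∀ x, x ∈ S := by
  let J : Module.End ℝ W := (Real.sqrt 3)⁻¹ • ((2 : ℝ) • T + LinearMap.id)
  have hJ : J * J = -1 := by
    ext x
    have h3 : (Real.sqrt 3)⁻¹ * (Real.sqrt 3)⁻¹ = (3 : ℝ)⁻¹ := by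
      rw [← mul_inv, Real.mul_self_sqrt (by norm_num)]
    have h := hT x
    have h' : T (T x) = - T x - x := by
      rw [← sub_eq_zero, ← h]; abel
    simp only [J, Module.End.mul_apply, LinearMap.smul_apply, LinearMap.add_apply,
      LinearMap.id_apply, map_smul, map_add, smul_add, smul_smul, h', smul_sub, smul_neg,
      LinearMap.neg_apply, Module.End.one_apply]
    have e : (Real.sqrt 3)⁻¹ * 2 * ((Real.sqrt 3)⁻¹ * 2) = 4 / 3 := by linear_combination 4 * h3
    have e2 : (Real.sqrt 3)⁻¹ * 2 * ((Real.sqrt 3)⁻¹) = 2 / 3 := by linear_combination 2 * h3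
    have e3 : (Real.sqrt 3)⁻¹ * ((Real.sqrt 3)⁻¹ * 2) = 2 / 3 := by linear_combination 2 * h3
    simp only [← mul_assoc] at *
    simp only [e, e2, e3, h3]
    module
  let φ : ℂ →ₐ[ℝ] Module.End ℝ W := Complex.liftAux J hJ
  letI : Module ℂ W := Module.compHom W φ.toRingHom
  have hsm : ∀ (z : ℂ) (x : W), z • x = z.re • x + z.im • J x := by
    intro z x
    change φ z x = _
    simp [φ, Complex.liftAux_apply]
  haveI : IsScalarTower ℝ ℂ W := by
    refine ⟨fun r z x => ?_⟩
    rw [hsm, hsm]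
    simp [smul_add, smul_smul]
  haveI : FiniteDimensional ℂ W := Module.Finite.right ℝ ℂ W
  refine ⟨Module.finrank ℂ W, Module.finBasis ℂ W, ?_, ?_⟩
  · rw [← Module.finrank_mul_finrank ℝ ℂ W, Complex.finrank_real_complex]
  · intro S h1 h2 x
    rw [← (Module.finBasis ℂ W).sum_repr x]
    refine S.sum_mem fun j _ => ?_
    rw [hsm]
    refine S.add_mem (S.smul_mem _ (h1 j)) (S.smul_mem _ ?_)
    exact S.smul_mem _ (S.add_mem (S.smul_mem _ (h2 j)) (h1 j))

section
variable {V : Type*} [AddCommGroup V] [Module ℝ V] [FiniteDimensional ℝ V]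

/-- Averaging operator. -/
lemma isProj_avg (T : V →ₗ[ℝ] V) (hT : ∀ x, T (T (T x)) = x) :
    LinearMap.IsProj (LinearMap.ker (T - (LinearMap.id : V →ₗ[ℝ] V)))
      ((3 : ℝ)⁻¹ • (LinearMap.id + T + T ∘ₗ T)) := by
  constructor
  · intro x
    simp only [LinearMap.mem_ker, LinearMap.sub_apply, LinearMap.smul_apply, LinearMap.add_apply,
      LinearMap.comp_apply, LinearMap.id_apply, map_smul, map_add, hT]
    module
  · intro x hx
    have hx' : T x = x := by
      simpa [LinearMap.mem_ker, sub_eq_zero] using hx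
    simp only [LinearMap.smul_apply, LinearMap.add_apply,
      LinearMap.comp_apply, LinearMap.id_apply, hx']
    module

lemma fixed_of_basis (T : V →ₗ[ℝ] V) (hT : ∀ x, T (T (T x)) = x) {ι : Type}
    (b : Module.Basis ι ℝ V) (h1 : ∀ i, ∃ i', T (b i) = b i' ∨ T (b i) = - b i')
    (h2 : ∀ i, ∃ i', T (T (b i)) = b i' ∨ T (T (b i)) = - b i') :
    Module.finrank ℝ V ≤
      3 * Module.finrank ℝ (LinearMap.ker (T - (LinearMap.id : V →ₗ[ℝ] V))) := by
  classical
  haveI : Fintype ι := FiniteDimensional.fintypeBasisIndex b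
  have key : ∀ U : V →ₗ[ℝ] V, (∀ x, U (U (U x)) = x) →
      (∀ i, ∃ i', U (b i) = b i' ∨ U (b i) = - b i') → 0 ≤ LinearMap.trace ℝ V U := by
    intro U hU h
    rw [LinearMap.trace_eq_matrix_trace ℝ b, Matrix.trace]
    refine Finset.sum_nonneg fun i _ => ?_
    rw [Matrix.diag_apply, LinearMap.toMatrix_apply]
    obtain ⟨i', h | h⟩ := h i
    · rw [h, b.repr_self, Finsupp.single_apply]; split_ifs <;> norm_num
    · by_cases hi : i' = i
      · subst hi
        have := hU (b i')
        rw [h, map_neg, h, neg_neg, h] at this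
        have h0 : (2 : ℝ) • b i' = 0 := by
          rw [two_smul]
          nth_rewrite 1 [← this]
          exact neg_add_cancel _
        exact absurd ((smul_eq_zero_iff_right (by norm_num)).1 h0) (b.ne_zero i')
      · rw [h, map_neg, b.repr_self, Finsupp.neg_apply, Finsupp.single_apply, if_neg hi]; simp
  have t1 := key T hT h1
  have t2 := key (T ∘ₗ T) (fun x => by simp [hT]) h2
  have t := (isProj_avg T hT).trace
  rw [map_smul, map_add, map_add, LinearMap.trace_id, smul_eq_mul] at t
  have : (Module.finrank ℝ V : ℝ) ≤
      3 * Module.finrank ℝ (LinearMap.ker (T - (LinearMap.id : V →ₗ[ℝ] V))) := by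
    linarith
  exact_mod_cast this

lemma basis_of_fixed (T : V →ₗ[ℝ] V) (hT : ∀ x, T (T (T x)) = x)
    (h : Module.finrank ℝ V ≤
      3 * Module.finrank ℝ (LinearMap.ker (T - (LinearMap.id : V →ₗ[ℝ] V)))) :
    ∃ (ι : Type) (b : Module.Basis ι ℝ V), ∀ i, ∃ i', T (b i) = b i' := by
  have hproj := isProj_avg T hT
  set F := LinearMap.ker (T - (LinearMap.id : V →ₗ[ℝ] V)) with hF
  set P := (3 : ℝ)⁻¹ • (LinearMap.id + T + T ∘ₗ T) with hP
  have hPx : ∀ x, P x = (3 : ℝ)⁻¹ • (x + T x + T (T x)) := fun x => rfl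
  have hFT : ∀ x ∈ F, T x = x := fun x hx => by
    simpa [hF, LinearMap.mem_ker, sub_eq_zero] using hx
  have hrange : LinearMap.range P = F := by
    ext x
    constructor
    · rintro ⟨y, rfl⟩; exact hproj.map_mem y
    · intro hx; exact ⟨x, hproj.map_id x hx⟩
  have hdim := LinearMap.finrank_range_add_finrank_ker P
  rw [hrange] at hdim
  have hker : ∀ x, x ∈ LinearMap.ker P ↔ T (T x) + T x + x = 0 := by
    intro x
    rw [LinearMap.mem_ker, hPx, smul_eq_zero_iff_right (by norm_num)]
    rw [show x + T x + T (T x) = T (T x) + T x + x by abel]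
  have hinv : ∀ x ∈ LinearMap.ker P, T x ∈ LinearMap.ker P := by
    intro x hx
    rw [hker] at hx ⊢
    rw [hT, ← hx]; abel
  obtain ⟨n, w, hn, hw⟩ := exists_complex_basis (T.restrict hinv) (by
    rintro ⟨x, hx⟩
    apply Subtype.ext
    exact (hker x).1 hx)
  rw [hn] at hdim
  obtain ⟨k, hk⟩ : ∃ k, Module.finrank ℝ F = n + k := ⟨Module.finrank ℝ F - n, by omega⟩
  let f : Module.Basis (Fin n ⊕ Fin k) ℝ F :=
    (Module.finBasisOfFinrankEq ℝ F hk).reindex finSumFinEquiv.symm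
  let v : (Fin n × Fin 3) ⊕ Fin k → V := Sum.elim
    (fun p => (f (Sum.inl p.1) : V) + (![(w p.1 : V), T (w p.1), T (T (w p.1))] p.2))
    (fun j => (f (Sum.inr j) : V))
  have hff : ∀ i, T (f i : V) = f i := fun i => hFT _ (f i).2
  have hww : ∀ j, T (T (w j : V)) + T (w j) + w j = 0 := fun j => (hker _).1 (w j).2
  have v0 : ∀ j, v (Sum.inl (j, 0)) = f (Sum.inl j) + w j := fun j => rfl
  have v1 : ∀ j, v (Sum.inl (j, 1)) = f (Sum.inl j) + T (w j) := fun j => rfl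
  have v2 : ∀ j, v (Sum.inl (j, 2)) = f (Sum.inl j) + T (T (w j)) := fun j => rfl
  have hspan : ⊤ ≤ Submodule.span ℝ (Set.range v) := by
    set S := Submodule.span ℝ (Set.range v) with hS
    have hv : ∀ i, v i ∈ S := fun i => Submodule.subset_span ⟨i, rfl⟩
    have hf1 : ∀ i, (f i : V) ∈ S := by
      rintro (j | j)
      · have e : (f (Sum.inl j) : V) = (3 : ℝ)⁻¹ •
            (v (Sum.inl (j, 0)) + v (Sum.inl (j, 1)) + v (Sum.inl (j, 2))) := by
          have : v (Sum.inl (j, 0)) + v (Sum.inl (j, 1)) + v (Sum.inl (j, 2))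
              = (3 : ℝ) • (f (Sum.inl j) : V) + (T (T (w j : V)) + T (w j) + w j) := by
            rw [v0, v1, v2]; module
          rw [this, hww, add_zero, smul_smul]; norm_num
        rw [e]
        exact S.smul_mem _ (S.add_mem (S.add_mem (hv _) (hv _)) (hv _))
      · exact hv (Sum.inr j)
    have hw0 : ∀ j, (w j : V) ∈ S := fun j => by
      have := S.sub_mem (hv (Sum.inl (j, 0))) (hf1 (Sum.inl j))
      rwa [v0, add_sub_cancel_left] at this
    have hw1 : ∀ j, T (w j : V) ∈ S := fun j => by
      have := S.sub_mem (hv (Sum.inl (j, 1))) (hf1 (Sum.inl j))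
      rwa [v1, add_sub_cancel_left] at this
    have hFS : ∀ x : F, (x : V) ∈ S := by
      intro x
      rw [← f.sum_repr x, Submodule.coe_sum]
      exact S.sum_mem fun i _ => S.smul_mem _ (hf1 i)
    have hWS : ∀ x : LinearMap.ker P, (x : V) ∈ S := fun x =>
      hw (S.comap (LinearMap.ker P).subtype) hw0 hw1 x
    intro x _
    have hxk : x - P x ∈ LinearMap.ker P := by
      rw [LinearMap.mem_ker, map_sub, hproj.map_id _ (hproj.map_mem x), sub_self]
    have := S.add_mem (hFS ⟨P x, hproj.map_mem x⟩) (hWS ⟨x - P x, hxk⟩)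
    simpa using this
  have hcard : Fintype.card ((Fin n × Fin 3) ⊕ Fin k) = Module.finrank ℝ V := by
    simp; omega
  refine ⟨_, basisOfTopLeSpanOfCardEqFinrank v hspan hcard, ?_⟩
  rw [coe_basisOfTopLeSpanOfCardEqFinrank]
  rintro (⟨j, a⟩ | j)
  · fin_cases a
    · refine ⟨Sum.inl (j, 1), ?_⟩
      change T (v (Sum.inl (j, 0))) = _
      rw [v0, v1, map_add, hff]
    · refine ⟨Sum.inl (j, 2), ?_⟩
      change T (v (Sum.inl (j, 1))) = _
      rw [v1, v2, map_add, hff]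
    · refine ⟨Sum.inl (j, 0), ?_⟩
      change T (v (Sum.inl (j, 2))) = _
      rw [v2, v0, map_add, hff, hT]
  · exact ⟨Sum.inr j, hff _⟩

end


/-- A finite-dimensional real vector space `V` with a linear `ℤ/3`-action has a
`ℤ/3`-invariant basis up to sign if and only if `3 · dim V^{ℤ/3} ≥ dim V`, where
`V^{ℤ/3} = {v : g • v = v}` is the subspace of vectors fixed by the generator `g`. -/
theorem hasInvSignBasis_iff_fixed {V : Type*} [AddCommGroup V] [Module ℝ V]
    [FiniteDimensional ℝ V] (ρ : Representation ℝ (Multiplicative (ZMod 3)) V) :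
    HasInvSignBasis ρ ↔
      3 * Module.finrank ℝ
          (LinearMap.ker (ρ (Multiplicative.ofAdd 1) - (LinearMap.id : V →ₗ[ℝ] V))) ≥
        Module.finrank ℝ V := by
  have hmul : ∀ (a b : Multiplicative (ZMod 3)) x, ρ a (ρ b x) = ρ (a * b) x := by
    intro a b x; rw [map_mul]; rfl
  have hT : ∀ x, ρ (Multiplicative.ofAdd 1) (ρ (Multiplicative.ofAdd 1)
      (ρ (Multiplicative.ofAdd 1) x)) = x := by
    intro x
    rw [hmul, hmul, show (Multiplicative.ofAdd (1 : ZMod 3)) * Multiplicative.ofAdd 1 *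
      Multiplicative.ofAdd 1 = 1 from by decide, map_one]
    rfl
  constructor
  · rintro ⟨ι, b, hb⟩
    refine fixed_of_basis _ hT b (hb _) fun i => ?_
    rw [hmul]
    exact hb _ i
  · intro h
    obtain ⟨ι, b, hb⟩ := basis_of_fixed _ hT h
    refine ⟨ι, b, fun g i => ?_⟩
    have hg : g = 1 ∨ g = Multiplicative.ofAdd 1 ∨
        g = Multiplicative.ofAdd 1 * Multiplicative.ofAdd 1 := by
      revert g; decide
    rcases hg with rfl | rfl | rfl
    · exact ⟨i, Or.inl (by rw [map_one]; rfl)⟩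
    · obtain ⟨i', h'⟩ := hb i
      exact ⟨i', Or.inl h'⟩
    · obtain ⟨i', h'⟩ := hb i
      obtain ⟨i'', h''⟩ := hb i'
      exact ⟨i'', Or.inl (by rw [← hmul, h', h''])⟩
end

section
/- Let ρ₃ be the regular representation of ℤ/3 = ⟨g⟩ on ℝ³, in which g acts by cyclically shifting coordinates: g • (x₀, x₁, x₂) = (x₂, x₀, x₁). Let V be a finite-dimensional real vector space with a linear ℤ/3-action and let n ∈ ℕ. Then V has a ℤ/3-invariant basis up to sign if and only if the direct sum V × (Fin n → ℝ³), with g acting on the second factor by ρ₃ on each copy and the action taken componentwise, has a ℤ/3-invariant basis up to sign. -/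
/-- The direct-sum (componentwise) representation of `G` on `V × W`. -/
def prodRep {G V W : Type*} [Group G] [AddCommGroup V] [Module ℝ V]
    [AddCommGroup W] [Module ℝ W]
    (ρV : Representation ℝ G V) (ρW : Representation ℝ G W) : Representation ℝ G (V × W) where
  toFun g := (ρV g).prodMap (ρW g)
  map_one' := by ext x <;> simp
  map_mul' g h := by ext x <;> simp [Module.End.mul_apply]

/-- The regular representation of `ℤ/3` on `ℝ³` (coordinates indexed by `ZMod 3`):
the generator `Multiplicative.ofAdd 1` acts by `(x₀, x₁, x₂) ↦ (x₂, x₀, x₁)`,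
i.e. `c` acts by `(c • x) i = x (i - c)`. -/
noncomputable def regRep : Representation ℝ (Multiplicative (ZMod 3)) (ZMod 3 → ℝ) where
  toFun c := LinearMap.funLeft ℝ ℝ (fun i => i - c.toAdd)
  map_one' := by
    ext x i
    simp [LinearMap.funLeft]
  map_mul' a b := by
    ext x i
    simp only [LinearMap.coe_comp, Function.comp_apply, Module.End.mul_apply,
      LinearMap.funLeft_apply, toAdd_mul]
    rw [sub_sub]

/-- The direct sum of `d` copies of the regular representation of `ℤ/3` on `ℝ³`. -/
noncomputable def copiesRegRep (d : ℕ) :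
    Representation ℝ (Multiplicative (ZMod 3)) (Fin d → ZMod 3 → ℝ) where
  toFun c := LinearMap.compLeft (regRep c) (Fin d)
  map_one' := by
    ext x i j
    simp [LinearMap.compLeft]
  map_mul' a b := by
    ext x i j
    simp [LinearMap.compLeft, Module.End.mul_apply]
    rfl

open Module in
lemma complex_span {U : Type*} [AddCommGroup U] [Module ℝ U] [FiniteDimensional ℝ U]
    (J : Module.End ℝ U) (hJ : J * J = -1) :
    ∃ (q : ℕ) (u : Fin q → U), finrank ℝ U = 2 * q ∧
      ∀ x, ∃ a b : Fin q → ℝ, x = ∑ i, (a i • u i + b i • J (u i)) := by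
  let φ : ℂ →ₐ[ℝ] Module.End ℝ U := Complex.lift ⟨J, hJ⟩
  letI : Module ℂ U := Module.compHom U φ.toRingHom
  have hs : ∀ (c : ℂ) (x : U), c • x = c.re • x + c.im • J x := by
    intro c x
    change φ c x = _
    simp [φ, Complex.lift_apply, Complex.liftAux_apply]
  haveI : IsScalarTower ℝ ℂ U := ⟨by
    intro r c x
    rw [hs, hs]
    simp [smul_add, mul_smul]⟩
  haveI : Module.Finite ℂ U := Module.Finite.of_restrictScalars_finite ℝ ℂ U
  refine ⟨finrank ℂ U, finBasis ℂ U, ?_, ?_⟩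
  · rw [← finrank_mul_finrank ℝ ℂ U, Complex.finrank_real_complex]
  · intro x
    refine ⟨fun i => ((finBasis ℂ U).repr x i).re, fun i => ((finBasis ℂ U).repr x i).im, ?_⟩
    conv_lhs => rw [← (finBasis ℂ U).sum_repr x]
    simp only [hs]

lemma cube_eq_one (c : Multiplicative (ZMod 3)) : c * (c * c) = 1 := by
  revert c; decide

lemma trace_nonneg_of_basis {V : Type*} [AddCommGroup V] [Module ℝ V]
    [FiniteDimensional ℝ V] (ρ : Representation ℝ (Multiplicative (ZMod 3)) V)
    (h : HasInvSignBasis ρ) (c : Multiplicative (ZMod 3)) : 0 ≤ LinearMap.trace ℝ V (ρ c) := by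
  classical
  obtain ⟨ι, b, hb⟩ := h
  haveI : Finite ι := Module.Finite.finite_basis b
  haveI := Fintype.ofFinite ι
  rw [LinearMap.trace_eq_matrix_trace ℝ b, Matrix.trace]
  refine Finset.sum_nonneg fun i _ => ?_
  rw [Matrix.diag_apply, LinearMap.toMatrix_apply]
  obtain ⟨j, hj | hj⟩ := hb c i
  · rw [hj, b.repr_self, Finsupp.single_apply]
    split_ifs <;> norm_num
  · by_cases hij : j = i
    · subst hij
      exfalso
      have h3 : ρ (c * (c * c)) (b j) = b j := by rw [cube_eq_one]; simp
      rw [map_mul, map_mul, Module.End.mul_apply, Module.End.mul_apply, hj, map_neg, hj,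
        neg_neg, hj] at h3
      have := congrArg (fun x => b.repr x j) h3
      simp at this
      norm_num at this
    · rw [hj, map_neg, b.repr_self, Finsupp.neg_apply, Finsupp.single_apply, if_neg hij]
      simp

lemma trace_copies (n : ℕ) (c : Multiplicative (ZMod 3)) (hc : c ≠ 1) :
    LinearMap.trace ℝ _ (copiesRegRep n c) = 0 := by
  classical
  rw [LinearMap.trace_eq_matrix_trace ℝ (Pi.basis (fun _ : Fin n => Pi.basisFun ℝ (ZMod 3))),
    Matrix.trace]
  refine Finset.sum_eq_zero fun i _ => ?_
  rw [Matrix.diag_apply, LinearMap.toMatrix_apply]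
  obtain ⟨i, j⟩ := i
  have hc' : c.toAdd ≠ 0 := fun h => hc (by simpa using h)
  simp [Pi.basis_repr, copiesRegRep, regRep, LinearMap.compLeft, LinearMap.funLeft, hc']

lemma trace_prodRep {V : Type*} [AddCommGroup V] [Module ℝ V]
    [FiniteDimensional ℝ V] (ρ : Representation ℝ (Multiplicative (ZMod 3)) V) (n : ℕ)
    (c : Multiplicative (ZMod 3)) (hc : c ≠ 1) :
    LinearMap.trace ℝ _ (prodRep ρ (copiesRegRep n) c) = LinearMap.trace ℝ V (ρ c) := by
  change LinearMap.trace ℝ _ ((ρ c).prodMap (copiesRegRep n c)) = _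
  rw [LinearMap.trace_prodMap', trace_copies n c hc, add_zero]

open Module in
lemma basis_of_trace_nonneg {V : Type*} [AddCommGroup V] [Module ℝ V]
    [FiniteDimensional ℝ V] (ρ : Representation ℝ (Multiplicative (ZMod 3)) V)
    (h : ∀ c ≠ 1, 0 ≤ LinearMap.trace ℝ V (ρ c)) : HasInvSignBasis ρ := by
  classical
  obtain ⟨T, hT⟩ : ∃ T, T = ρ (Multiplicative.ofAdd 1) := ⟨_, rfl⟩
  have hT2 : ρ (Multiplicative.ofAdd 2) = T * T := by
    rw [hT, ← map_mul]; rfl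
  have hT0 : ρ (Multiplicative.ofAdd 0) = 1 := by
    rw [ofAdd_zero, map_one]
  have hT3 : T * (T * T) = 1 := by
    rw [hT, ← map_mul, ← map_mul, cube_eq_one, map_one]
  have hT3' : ∀ x, T (T (T x)) = x := fun x => by
    simpa using LinearMap.congr_fun hT3 x
  obtain ⟨P, hP⟩ : ∃ P : Module.End ℝ V, P = (1/3 : ℝ) • (1 + T + T * T) := ⟨_, rfl⟩
  have hPx : ∀ x, P x = (1/3 : ℝ) • (x + T x + T (T x)) := fun x => by simp [hP]
  have hTP : ∀ x, T (P x) = P x := fun x => by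
    simp only [hPx, map_smul, map_add, hT3']; module
  have hPT : ∀ x, P (T x) = P x := fun x => by
    simp only [hPx, hT3']; module
  have hPP : ∀ x, P (P x) = P x := fun x => by
    rw [hPx (P x)]; simp only [hTP]; module
  have htr : 0 ≤ LinearMap.trace ℝ V T + LinearMap.trace ℝ V (T * T) := by
    rw [← hT2, hT]
    exact add_nonneg (h _ (by decide)) (h _ (by decide))
  have hproj : LinearMap.IsProj (LinearMap.range P) P :=
    ⟨fun x => ⟨x, rfl⟩, by rintro _ ⟨x, rfl⟩; exact hPP x⟩
  have htrP : LinearMap.trace ℝ V P = finrank ℝ (LinearMap.range P) := hproj.trace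
  have hrn := LinearMap.finrank_range_add_finrank_ker P
  -- complex structure on the kernel
  have hker : ∀ x ∈ LinearMap.ker P, T x ∈ LinearMap.ker P := fun x hx => by
    rw [LinearMap.mem_ker] at *; rw [hPT, hx]
  let S : Module.End ℝ (LinearMap.ker P) := T.restrict hker
  have hS : ∀ x, ((S x : LinearMap.ker P) : V) = T x := fun x => rfl
  have hsum : ∀ x : LinearMap.ker P, (x : V) + T x + T (T x) = 0 := fun x => by
    have := x.2
    rw [LinearMap.mem_ker, hPx] at this
    exact (smul_eq_zero.mp this).resolve_left (by norm_num)
  have h3 : (Real.sqrt 3)⁻¹ * (Real.sqrt 3)⁻¹ = 1/3 := by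
    rw [← mul_inv, Real.mul_self_sqrt (by norm_num)]; norm_num
  let J : Module.End ℝ (LinearMap.ker P) := (Real.sqrt 3)⁻¹ • ((2:ℝ) • S + 1)
  have hJ' : ∀ x : LinearMap.ker P, ((J x : LinearMap.ker P) : V)
      = (Real.sqrt 3)⁻¹ • ((2:ℝ) • T x + x) := fun x => by
    simp [J, hS]
  have hJ : J * J = -1 := by
    ext x
    rw [Module.End.mul_apply, hJ', hJ']
    have e := hsum x
    have e' : T (T (x:V)) = -(x:V) - T x := by
      rw [← sub_eq_zero, ← e]; abel
    simp only [map_smul, map_add, e']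
    have : (Real.sqrt 3)⁻¹ • ((2:ℝ) • (Real.sqrt 3)⁻¹ • ((2:ℝ) • (-(x:V) - T x) + T x)
        + (Real.sqrt 3)⁻¹ • ((2:ℝ) • T x + (x:V))) =
        ((Real.sqrt 3)⁻¹ * (Real.sqrt 3)⁻¹) • ((-3:ℝ) • (x:V)) := by module
    rw [this, h3, smul_smul]
    norm_num
  obtain ⟨q, u, hq, hu⟩ := complex_span J hJ
  let p := finrank ℝ (LinearMap.range P)
  have hp : finrank ℝ (LinearMap.range P) = p := rfl
  let e := finBasis ℝ (LinearMap.range P)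
  have hqp : q ≤ p := by
    have h1 : LinearMap.trace ℝ V P = (1/3) * ((finrank ℝ V : ℝ) + LinearMap.trace ℝ V T
        + LinearMap.trace ℝ V (T * T)) := by
      rw [hP, map_smul, map_add, map_add, LinearMap.trace_one]; simp
    have h2 : (p : ℝ) + 2 * q = finrank ℝ V := by
      rw [← hrn, hq]; push_cast; rfl
    rw [htrP, hp] at h1
    have : (q : ℝ) ≤ p := by linarith
    exact_mod_cast this
  let v : (Fin q × ZMod 3) ⊕ {i : Fin p // q ≤ i} → V :=
    Sum.elim (fun x => (e (Fin.castLE hqp x.1) : V) + ρ (Multiplicative.ofAdd x.2) (u x.1))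
      (fun i => (e i : V))
  have hTe : ∀ (c : Multiplicative (ZMod 3)) (x : LinearMap.range P), ρ c (x:V) = x := by
    rintro c ⟨_, ⟨x, rfl⟩⟩
    have hc : c = Multiplicative.ofAdd 0 ∨ c = Multiplicative.ofAdd 1 ∨
      c = Multiplicative.ofAdd 2 := by revert c; decide
    rcases hc with rfl | rfl | rfl
    · rw [hT0]; rfl
    · rw [← hT]; exact hTP x
    · rw [hT2, Module.End.mul_apply]; simp only [hTP]
  have hv : ∀ i k, (e (Fin.castLE hqp i) : V) + ρ (Multiplicative.ofAdd k) (u i)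
      ∈ Submodule.span ℝ (Set.range v) := fun i k => Submodule.subset_span ⟨Sum.inl (i, k), rfl⟩
  have he : ∀ i, (e i : V) ∈ Submodule.span ℝ (Set.range v) := by
    intro i
    by_cases hi : q ≤ i
    · exact Submodule.subset_span ⟨Sum.inr ⟨i, hi⟩, rfl⟩
    · obtain ⟨j, rfl⟩ : ∃ j : Fin q, i = Fin.castLE hqp j := ⟨⟨i, by omega⟩, rfl⟩
      have h0 := hv j 0
      have h1 := hv j 1
      have h2 := hv j 2
      rw [hT0, Module.End.one_apply] at h0
      rw [← hT] at h1
      rw [hT2, Module.End.mul_apply] at h2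
      have := Submodule.smul_mem _ (1/3 : ℝ) (Submodule.add_mem _ (Submodule.add_mem _ h0 h1) h2)
      convert this using 1
      have e1 := hsum (u j)
      have e' : T (T (u j:V)) = -(u j:V) - T (u j) := by
        rw [← sub_eq_zero, ← e1]; abel
      rw [e']; module
  have huk : ∀ i k, ρ (Multiplicative.ofAdd k) (u i) ∈ Submodule.span ℝ (Set.range v) := by
    intro i k
    have := Submodule.sub_mem _ (hv i k) (he (Fin.castLE hqp i))
    simpa using this
  have hspan : ⊤ ≤ Submodule.span ℝ (Set.range v) := by
    intro x _
    have h1 : P x ∈ Submodule.span ℝ (Set.range v) := by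
      have := congrArg Subtype.val (e.sum_repr ⟨P x, x, rfl⟩)
      rw [← (show _ = P x from this), Submodule.coe_sum]
      refine Submodule.sum_mem _ fun i _ => ?_
      rw [Submodule.coe_smul]
      exact Submodule.smul_mem _ _ (he i)
    have h2 : x - P x ∈ Submodule.span ℝ (Set.range v) := by
      obtain ⟨a, b, hab⟩ := hu ⟨x - P x, by rw [LinearMap.mem_ker, map_sub, hPP, sub_self]⟩
      have := congrArg Subtype.val hab
      rw [show x - P x = _ from this, Submodule.coe_sum]
      refine Submodule.sum_mem _ fun i _ => ?_
      have h0 := huk i 0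
      have h1 := huk i 1
      rw [hT0, Module.End.one_apply] at h0
      rw [← hT] at h1
      rw [Submodule.coe_add, Submodule.coe_smul, Submodule.coe_smul, hJ']
      exact Submodule.add_mem _ (Submodule.smul_mem _ _ h0) (Submodule.smul_mem _ _
        (Submodule.smul_mem _ _ (Submodule.add_mem _ (Submodule.smul_mem _ _ h1) h0)))
    simpa using Submodule.add_mem _ h1 h2
  have hcard : Fintype.card ((Fin q × ZMod 3) ⊕ {i : Fin p // q ≤ i}) = finrank ℝ V := by
    have hsub : Fintype.card {i : Fin p // q ≤ i} = p - q := by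
      have h1 := Fintype.card_subtype_compl (fun i : Fin p => (i : ℕ) < q)
      have h2 : Fintype.card {i : Fin p // (i : ℕ) < q} = q := by
        rw [← Fintype.card_fin q]
        exact Fintype.card_congr
          { toFun := fun i => ⟨i.1, by simpa using i.2⟩
            invFun := fun i => ⟨⟨i, by have := i.2; simp at this; omega⟩, by simpa using i.2⟩
            left_inv := fun i => rfl
            right_inv := fun i => rfl }
      rw [h2, Fintype.card_fin] at h1
      rw [← h1]
      exact Fintype.card_congr (Equiv.subtypeEquivRight (fun i => by simp))
    rw [Fintype.card_sum, Fintype.card_prod, hsub, Fintype.card_fin, ZMod.card, ← hrn, hq, hp]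
    omega
  refine ⟨_, basisOfTopLeSpanOfCardEqFinrank v hspan hcard, ?_⟩
  intro c i
  rw [coe_basisOfTopLeSpanOfCardEqFinrank]
  rcases i with ⟨i, k⟩ | i
  · refine ⟨Sum.inl (i, c.toAdd + k), Or.inl ?_⟩
    simp only [v, Sum.elim_inl, map_add, hTe, ofAdd_add, ofAdd_toAdd, map_mul,
      Module.End.mul_apply]
  · exact ⟨Sum.inr i, Or.inl (hTe c _)⟩

theorem hasInvSignBasis_iff_sum_regular {V : Type*} [AddCommGroup V] [Module ℝ V]
    [FiniteDimensional ℝ V] (ρ : Representation ℝ (Multiplicative (ZMod 3)) V) (n : ℕ) :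
    HasInvSignBasis ρ ↔ HasInvSignBasis (prodRep ρ (copiesRegRep n)) := by
  constructor
  · intro h
    refine basis_of_trace_nonneg _ fun c hc => ?_
    rw [trace_prodRep ρ n c hc]
    exact trace_nonneg_of_basis ρ h c
  · intro h
    refine basis_of_trace_nonneg _ fun c hc => ?_
    rw [← trace_prodRep ρ n c hc]
    exact trace_nonneg_of_basis _ h c
end
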